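/- arXiv:0805.1391 — 4 statements merged into one kernel-verified Lean document; each statement's English description precedes it below -/
import Mathlib

section
/- For every game graph G = ((S,E),(S₁,S₂)) and every priority function p : S → {0,…,d−1}, the winning sets of the two players for the complementary weak-parity objectives partition the state space: W₁^G(WeakParityEven(p)) = S \ W₂^G(WeakParityOdd(p)). -/
open scoped Classical

/-! Framework for two-player games on graphs.

A game graph on a state type `S` is given by an edge relation `E : S → S → Prop`,
the set `S1 : Set S` of player-1 states (player-2 states are `S1ᶜ`), together with
the assumption that every state has a successor.  To deal uniformly with sub-games,
all notions are relativized to a carrier set `C : Set S` of states (the full game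
corresponds to `C = Set.univ`). -/

/-- A (history-dependent) strategy for player 1 in the game with carrier `C`:
given the history `w` (the play so far, excluding the current state) and the
current state `s` (a player-1 state of the game), it chooses a successor of `s`
inside the game. -/
def Strategy1 {S : Type} (C : Set S) (E : S → S → Prop) (S1 : Set S)
    (σ : List S → S → S) : Prop :=
  ∀ w s, s ∈ C → s ∈ S1 → E s (σ w s) ∧ σ w s ∈ C

/-- A (history-dependent) strategy for player 2 in the game with carrier `C`. -/
def Strategy2 {S : Type} (C : Set S) (E : S → S → Prop) (S1 : Set S)
    (π : List S → S → S) : Prop :=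
  ∀ w s, s ∈ C → s ∉ S1 → E s (π w s) ∧ π w s ∈ C

/-- Auxiliary function: the pair (history, current state) after `n` steps of the
play from `s` in which player 1 follows `σ` and player 2 follows `π`. -/
noncomputable def playAux {S : Type} (S1 : Set S) (σ π : List S → S → S) (s : S) :
    ℕ → List S × S
  | 0 => ([], s)
  | n + 1 =>
      let prev := playAux S1 σ π s n
      (prev.1 ++ [prev.2],
        if prev.2 ∈ S1 then σ prev.1 prev.2 else π prev.1 prev.2)

/-- The unique play `ω(s, σ, π)` starting from `s` in which player 1 follows `σ`
and player 2 follows `π`. -/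
noncomputable def play {S : Type} (S1 : Set S) (σ π : List S → S → S) (s : S)
    (n : ℕ) : S :=
  (playAux S1 σ π s n).2

/-- The winning set of player 1 for the objective `Φ` in the game with carrier `C`. -/
def W1 {S : Type} (C : Set S) (E : S → S → Prop) (S1 : Set S)
    (Φ : Set (ℕ → S)) : Set S :=
  {s | s ∈ C ∧ ∃ σ, Strategy1 C E S1 σ ∧
        ∀ π, Strategy2 C E S1 π → play S1 σ π s ∈ Φ}

/-- The winning set of player 2 for the objective `Ψ` in the game with carrier `C`. -/
def W2 {S : Type} (C : Set S) (E : S → S → Prop) (S1 : Set S)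
    (Ψ : Set (ℕ → S)) : Set S :=
  {s | s ∈ C ∧ ∃ π, Strategy2 C E S1 π ∧
        ∀ σ, Strategy1 C E S1 σ → play S1 σ π s ∈ Ψ}

/-- The reachability objective: some state of `T` is visited. -/
def Reach {S : Type} (T : Set S) : Set (ℕ → S) := {ω | ∃ k, ω k ∈ T}

/-- The safety objective: only states of `F` are visited. -/
def Safe {S : Type} (F : Set S) : Set (ℕ → S) := {ω | ∀ k, ω k ∈ F}

/-- The weak-parity objective for player 1: the minimal priority occurring in the
play is even. -/
def WeakParityEven {S : Type} (p : S → ℕ) : Set (ℕ → S) :=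
  {ω | Even (sInf (p '' Set.range ω))}

/-- The weak-parity objective for player 2: the minimal priority occurring in the
play is odd. -/
def WeakParityOdd {S : Type} (p : S → ℕ) : Set (ℕ → S) :=
  {ω | Odd (sInf (p '' Set.range ω))}

/-- The player-1 attractor of `U` in the game with carrier `C`. -/
def Attr1 {S : Type} (C : Set S) (E : S → S → Prop) (S1 : Set S) (U : Set S) :
    Set S :=
  W1 C E S1 (Reach U)

/-- The player-2 attractor of `U` in the game with carrier `C`. -/
def Attr2 {S : Type} (C : Set S) (E : S → S → Prop) (S1 : Set S) (U : Set S) :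
    Set S :=
  W2 C E S1 (Reach U)

/-- Controllable predecessor for the player owning `P`. -/
def CPreP {S : Type} (E : S → S → Prop) (P : Set S) (Y : S → Prop) (s : S) : Prop :=
  (s ∈ P → ∃ t, E s t ∧ Y t) ∧ (s ∉ P → ∀ t, E s t → Y t)

theorem CPreP.mono {S : Type} {E : S → S → Prop} {P : Set S} {Y Z : S → Prop} {s : S}
    (h : CPreP E P Y s) (hYZ : ∀ t, Y t → Z t) : CPreP E P Z s := by
  refine ⟨fun hs => ?_, fun hs t ht => hYZ t (h.2 hs t ht)⟩
  obtain ⟨t, ht, hy⟩ := h.1 hs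
  exact ⟨t, ht, hYZ t hy⟩

theorem not_CPreP {S : Type} {E : S → S → Prop} {P : Set S} {Y : S → Prop} {s : S}
    (h : ¬ CPreP E P Y s) : CPreP E Pᶜ (fun t => ¬ Y t) s := by
  refine ⟨fun hs => ?_, fun hs t ht hy => ?_⟩
  · by_contra hc
    push Not at hc
    exact h ⟨fun h' => absurd h' hs, fun _ t ht => hc t ht⟩
  · have hs' : s ∈ P := by simpa using hs
    exact h ⟨fun _ => ⟨t, ht, hy⟩, fun h' => absurd hs' h'⟩

/-- Stages of the attractor. -/
noncomputable def stageP {S : Type} (E : S → S → Prop) (P : Set S) (C B : S → Prop) :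
    ℕ → S → Prop
  | 0 => fun _ => False
  | n + 1 => CPreP E P (fun t => if C t then B t else stageP E P C B n t)

theorem attractor_lemma {S : Type} [Fintype S] (E : S → S → Prop) (P : Set S)
    (C B : S → Prop) : ∃ (X : S → Prop) (r : S → ℕ), ∀ s,
      (X s → CPreP E P (fun t => (if C t then B t else X t) ∧ (C t ∨ r t < r s)) s) ∧
      (¬ X s → CPreP E Pᶜ (fun t => ¬ (if C t then B t else X t)) s) := by
  have hmono1 : ∀ n s, stageP E P C B n s → stageP E P C B (n + 1) s := by
    intro n
    induction n with
    | zero => intro s h; exact h.elim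
    | succ n ih =>
      intro s h
      refine CPreP.mono h fun t ht => ?_
      by_cases hC : C t
      · simpa [hC] using ht
      · simp only [hC, if_false] at ht ⊢
        exact ih t ht
  have hmono : ∀ s, Monotone (fun n => stageP E P C B n s) := fun s =>
    monotone_nat_of_le_succ fun n => hmono1 n s
  refine ⟨fun s => ∃ n, stageP E P C B n s, fun s => sInf {n | stageP E P C B n s}, fun s => ?_⟩
  constructor
  · intro hX
    have hmem : stageP E P C B (sInf {n | stageP E P C B n s}) s := Nat.sInf_mem hX
    generalize hk : sInf {n | stageP E P C B n s} = k at hmem ⊢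
    cases k with
    | zero => exact hmem.elim
    | succ k =>
      refine CPreP.mono hmem fun t ht => ?_
      by_cases hC : C t
      · simpa [hC] using ht
      · simp only [hC, if_false, false_or] at ht ⊢
        exact ⟨⟨k, ht⟩, lt_of_lt_of_eq (Nat.lt_succ_of_le (Nat.sInf_le ht)) hk.symm⟩
  · intro hX
    apply not_CPreP
    intro hc
    apply hX
    let N := Finset.univ.sup (fun t : S => sInf {n | stageP E P C B n t})
    refine ⟨N + 1, CPreP.mono hc fun t ht => ?_⟩
    by_cases hC : C t
    · simpa [hC] using ht
    · simp only [hC, if_false] at ht ⊢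
      exact hmono t (Finset.le_sup (f := fun t : S => sInf {n | stageP E P C B n t})
        (Finset.mem_univ t)) (Nat.sInf_mem ht)

theorem step_lemma {S : Type} [Fintype S] (E : S → S → Prop) (S1 : Set S) (p : S → ℕ)
    (m : ℕ) (B : S → Prop) : ∃ (X : S → Prop) (r : S → ℕ), ∀ s,
      (X s → CPreP E S1 (fun t => (if p t < m then B t else X t) ∧
        (Even m ∨ p t < m ∨ r t < r s)) s) ∧
      (¬ X s → CPreP E S1ᶜ (fun t => ¬ (if p t < m then B t else X t) ∧
        (Odd m ∨ p t < m ∨ r t < r s)) s) := by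
  rcases Nat.even_or_odd m with hm | hm
  · obtain ⟨X, r, h⟩ := attractor_lemma E S1ᶜ (fun t => p t < m) (fun t => ¬ B t)
    refine ⟨fun s => ¬ X s, r, fun s => ⟨fun hX => ?_, fun hX => ?_⟩⟩
    · have := (h s).2 hX
      rw [compl_compl] at this
      refine this.mono fun t ht => ⟨?_, Or.inl hm⟩
      split_ifs at ht ⊢ <;> simpa using ht
    · refine ((h s).1 (not_not.1 hX)).mono fun t ht => ⟨?_, Or.inr ht.2⟩
      have := ht.1
      split_ifs at this ⊢ <;> simpa using this
  · obtain ⟨X, r, h⟩ := attractor_lemma E S1 (fun t => p t < m) B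
    refine ⟨X, r, fun s => ⟨fun hX => ?_, fun hX => ?_⟩⟩
    · exact ((h s).1 hX).mono fun t ht => ⟨by convert ht.1, Or.inr ht.2⟩
    · exact ((h s).2 hX).mono fun t ht => ⟨by convert ht, Or.inl hm⟩

noncomputable def winRec {S : Type} (p : S → ℕ) (X : ℕ → (S → Prop) → S → Prop) :
    ℕ → S → Prop
  | m => X m (fun t => if _h : p t < m then winRec p X (p t) t else False)
termination_by m => m

theorem win_exists {S : Type} [Fintype S] (E : S → S → Prop) (S1 : Set S) (p : S → ℕ) :
    ∃ (Win : ℕ → S → Prop) (r : ℕ → S → ℕ), ∀ m s,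
      (Win m s → CPreP E S1 (fun t => Win (min m (p t)) t ∧
        (Even m ∨ p t < m ∨ r m t < r m s)) s) ∧
      (¬ Win m s → CPreP E S1ᶜ (fun t => ¬ Win (min m (p t)) t ∧
        (Odd m ∨ p t < m ∨ r m t < r m s)) s) := by
  choose X r h using step_lemma E S1 p
  have key : ∀ m, winRec p X m =
      X m (fun t => if _h : p t < m then winRec p X (p t) t else False) := by
    intro m; rw [winRec]
  refine ⟨winRec p X, fun m => r m
    (fun t => if _h : p t < m then winRec p X (p t) t else False), fun m s => ?_⟩
  have hN : ∀ t, (if p t < m then (if _h : p t < m then winRec p X (p t) t else False)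
      else winRec p X m t) ↔ winRec p X (min m (p t)) t := by
    intro t
    by_cases hlt : p t < m
    · simp [hlt, min_eq_right hlt.le]
    · simp [hlt, min_eq_left (not_lt.1 hlt)]
  have h0 := h m (fun t => if _h : p t < m then winRec p X (p t) t else False) s
  rw [← key m] at h0
  exact ⟨fun hX => (h0.1 hX).mono fun t ht => ⟨(hN t).1 ht.1, ht.2⟩,
    fun hX => (h0.2 hX).mono fun t ht => ⟨fun hc => ht.1 ((hN t).2 hc), ht.2⟩⟩

/-- The minimal priority seen, for history `w` and current state `s`. -/
def memP {S : Type} (p : S → ℕ) (w : List S) (s : S) : ℕ :=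
  (w ++ [s]).foldr (fun a b => min (p a) b) (p s)

theorem memP_snoc_aux {S : Type} (p : S → ℕ) (w : List S) (a b : ℕ) :
    w.foldr (fun x y => min (p x) y) (min a b) = min (w.foldr (fun x y => min (p x) y) a) b := by
  induction w with
  | nil => rfl
  | cons x w ih => simp [ih, min_assoc]

theorem memP_snoc {S : Type} (p : S → ℕ) (w : List S) (s t : S) :
    memP p (w ++ [s]) t = min (memP p w s) (p t) := by
  simp [memP, ← memP_snoc_aux]

theorem strat_lemma {S : Type} (E : S → S → Prop) (P : Set S) (hE : ∀ s, ∃ t, E s t)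
    (p : S → ℕ) (g : ℕ → Prop) (Win : ℕ → S → Prop) (r : ℕ → S → ℕ)
    (h : ∀ m s, Win m s → CPreP E P (fun t => Win (min m (p t)) t ∧
        (g m ∨ p t < m ∨ r m t < r m s)) s) :
    ∃ σ : List S → S → S, (∀ w s, E s (σ w s)) ∧
      ∀ x : ℕ → S, Win (p (x 0)) (x 0) → (∀ n, E (x n) (x (n + 1))) →
        (∀ n, x n ∈ P → x (n + 1) = σ ((List.range n).map x) (x n)) →
        g (sInf (p '' Set.range x)) := by
  have hch : ∀ (w : List S) (s : S), ∃ t, E s t ∧ (s ∈ P → Win (memP p w s) s →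
      Win (min (memP p w s) (p t)) t ∧
        (g (memP p w s) ∨ p t < memP p w s ∨ r (memP p w s) t < r (memP p w s) s)) := by
    intro w s
    by_cases hs : s ∈ P ∧ Win (memP p w s) s
    · obtain ⟨t, ht, h2⟩ := (h _ _ hs.2).1 hs.1
      exact ⟨t, ht, fun _ _ => h2⟩
    · obtain ⟨t, ht⟩ := hE s
      exact ⟨t, ht, fun h1 h2 => absurd ⟨h1, h2⟩ hs⟩
  choose σ hσE hσ using hch
  refine ⟨σ, hσE, fun x hx0 hxE hxσ => ?_⟩
  let μ : ℕ → ℕ := fun n => memP p ((List.range n).map x) (x n)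
  have hμ0 : μ 0 = p (x 0) := by simp [μ, memP]
  have hμs : ∀ n, μ (n + 1) = min (μ n) (p (x (n + 1))) := by
    intro n
    simp only [μ, List.range_succ, List.map_append, List.map_cons, List.map_nil]
    exact memP_snoc _ _ _ _
  have hstep : ∀ n, Win (μ n) (x n) → Win (μ (n + 1)) (x (n + 1)) ∧
      (g (μ n) ∨ p (x (n + 1)) < μ n ∨ r (μ n) (x (n + 1)) < r (μ n) (x n)) := by
    intro n hw
    rw [hμs]
    by_cases hP : x n ∈ P
    · rw [hxσ n hP]
      exact hσ _ _ hP hw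
    · exact (h _ _ hw).2 hP _ (hxE n)
  have hwin : ∀ n, Win (μ n) (x n) := by
    intro n
    induction n with
    | zero => rw [hμ0]; exact hx0
    | succ n ih => exact (hstep n ih).1
  have hanti : Antitone μ := antitone_nat_of_succ_le fun n => by rw [hμs]; exact min_le_left _ _
  have hle : ∀ n, μ n ≤ p (x n) := by
    intro n
    cases n with
    | zero => rw [hμ0]
    | succ n => rw [hμs]; exact min_le_right _ _
  set M := sInf (p '' Set.range x) with hM
  have hMle : ∀ n, M ≤ p (x n) := fun n => Nat.sInf_le ⟨x n, ⟨n, rfl⟩, rfl⟩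
  have hMμ : ∀ n, M ≤ μ n := by
    intro n
    induction n with
    | zero => rw [hμ0]; exact hMle 0
    | succ n ih => rw [hμs]; exact le_min ih (hMle _)
  obtain ⟨_, ⟨N, rfl⟩, hN⟩ : M ∈ p '' Set.range x :=
    Nat.sInf_mem ⟨p (x 0), x 0, ⟨0, rfl⟩, rfl⟩
  have hconst : ∀ n, μ (N + n) = M := fun n =>
    le_antisymm ((hanti (Nat.le_add_right N n)).trans ((hle N).trans hN.le)) (hMμ _)
  by_contra hg
  have hdec : ∀ n, r M (x (N + n)) + n ≤ r M (x N) := by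
    intro n
    induction n with
    | zero => simp
    | succ n ih =>
      have h1 := (hstep (N + n) (hwin _)).2
      rw [hconst] at h1
      rcases h1 with h1 | h1 | h1
      · exact absurd h1 hg
      · exact absurd h1 (not_lt.2 (hMle _))
      · rw [← add_assoc N n 1]; omega
  have := hdec (r M (x N) + 1)
  omega

theorem playAux_fst {S : Type} (S1 : Set S) (σ π : List S → S → S) (s : S) (n : ℕ) :
    (playAux S1 σ π s n).1 = (List.range n).map (play S1 σ π s) := by
  induction n with
  | zero => rfl
  | succ n ih =>
    rw [List.range_succ, List.map_append, ← ih]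
    rfl

theorem play_succ {S : Type} (S1 : Set S) (σ π : List S → S → S) (s : S) (n : ℕ) :
    play S1 σ π s (n + 1) = if play S1 σ π s n ∈ S1
      then σ ((List.range n).map (play S1 σ π s)) (play S1 σ π s n)
      else π ((List.range n).map (play S1 σ π s)) (play S1 σ π s n) := by
  rw [← playAux_fst]
  rfl

theorem play_edge {S : Type} (E : S → S → Prop) (S1 : Set S) (σ π : List S → S → S) (s : S)
    (hσ : Strategy1 Set.univ E S1 σ) (hπ : Strategy2 Set.univ E S1 π) (n : ℕ) :
    E (play S1 σ π s n) (play S1 σ π s (n + 1)) := by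
  rw [play_succ]
  split_ifs with h
  · exact (hσ _ _ trivial h).1
  · exact (hπ _ _ trivial h).1

/-- For every game graph `G = ((S,E),(S₁,S₂))` and priority
function `p : S → {0,…,d−1}`, the winning sets for the complementary weak-parity
objectives partition the state space:
`W₁ᴳ(WeakParityEven(p)) = S \ W₂ᴳ(WeakParityOdd(p))`. -/
theorem weak_parity_determinacy {S : Type} [Fintype S]
    (E : S → S → Prop) (S1 : Set S) (hE : ∀ s, ∃ t, E s t)
    (d : ℕ) (p : S → ℕ) (hp : ∀ s, p s < d) :
    W1 Set.univ E S1 (WeakParityEven p) =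
      Set.univ \ W2 Set.univ E S1 (WeakParityOdd p) := by
  obtain ⟨Win, r, h⟩ := win_exists E S1 p
  obtain ⟨σ, hσE, hσ⟩ := strat_lemma E S1 hE p (fun m => Even m) Win r (fun m s => (h m s).1)
  obtain ⟨π, hπE, hπ⟩ := strat_lemma E S1ᶜ hE p (fun m => Odd m) (fun m s => ¬ Win m s) r
    (fun m s => (h m s).2)
  have hσs : Strategy1 Set.univ E S1 σ := fun w s _ _ => ⟨hσE w s, trivial⟩
  have hπs : Strategy2 Set.univ E S1 π := fun w s _ _ => ⟨hπE w s, trivial⟩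
  have hdisj : ∀ ω : ℕ → S, ω ∈ WeakParityEven p → ω ∈ WeakParityOdd p → False :=
    fun ω h1 h2 => (Nat.not_even_iff_odd.2 h2) h1
  ext s
  simp only [Set.mem_sdiff, Set.mem_univ, true_and]
  constructor
  · rintro ⟨_, σ', hσ', h1⟩ ⟨_, π', hπ', h2⟩
    exact hdisj _ (h1 π' hπ') (h2 σ' hσ')
  · intro hs
    by_cases hw : Win (p s) s
    · refine ⟨trivial, σ, hσs, fun π' hπ' => ?_⟩
      refine hσ (play S1 σ π' s) hw (play_edge E S1 σ π' s hσs hπ') fun n hn => ?_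
      rw [play_succ, if_pos hn]
    · refine absurd ⟨trivial, π, hπs, fun σ' hσ' => ?_⟩ hs
      refine hπ (play S1 σ' π s) hw (play_edge E S1 σ' π s hσ' hπs) fun n hn => ?_
      rw [play_succ, if_neg hn]
end

section
/- For every game graph G = ((S,E),(S₁,S₂)) and every priority function p : S → {0,…,d−1}, player 1 has a single memoryless strategy σ : S₁ → S (with σ(s) ∈ E(s) for all s ∈ S₁) that is winning for the objective WeakParityEven(p) from every state of the winning set W₁^G(WeakParityEven(p)); that is, for every s ∈ W₁^G(WeakParityEven(p)) and every player-2 strategy π, the play ω(s,σ,π) ∈ WeakParityEven(p). -/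
open scoped Classical

/-- States owned by the player of parity `i` (even: player 1). -/
def ownSet {S : Type} (S1 : Set S) (i : ℕ) : Set S := {s | s ∈ S1 ↔ i % 2 = 0}

/-- Attractor layers for the player of parity `i` to priority `i` inside `C`. -/
def attLayer {S : Type} (E : S → S → Prop) (S1 : Set S) (p : S → ℕ) (C : Set S) (i : ℕ) :
    ℕ → Set S
  | 0 => {s | s ∈ C ∧ p s = i}
  | n + 1 => attLayer E S1 p C i n ∪
      {s | s ∈ C ∧ ((s ∈ ownSet S1 i ∧ ∃ t, E s t ∧ t ∈ attLayer E S1 p C i n) ∨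
        (s ∉ ownSet S1 i ∧ ∀ t, E s t → t ∈ C → t ∈ attLayer E S1 p C i n))}

/-- The remaining sub-game after removing the first `i` attractors. -/
def remGame {S : Type} (E : S → S → Prop) (S1 : Set S) (p : S → ℕ) : ℕ → Set S
  | 0 => Set.univ
  | i + 1 => {s | s ∈ remGame E S1 p i ∧ ∀ n, s ∉ attLayer E S1 p (remGame E S1 p i) i n}

section aux
variable {S : Type} (E : S → S → Prop) (S1 : Set S) (p : S → ℕ)

theorem attLayer_sub (C : Set S) (i n : ℕ) : attLayer E S1 p C i n ⊆ C := by
  induction n with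
  | zero => exact fun s h => h.1
  | succ n ih =>
    intro s h
    rcases h with h | h
    · exact ih h
    · exact h.1

theorem attLayer_mono (C : Set S) (i : ℕ) : Monotone (attLayer E S1 p C i) :=
  monotone_nat_of_le_succ fun _ _ h => Or.inl h

theorem remGame_anti : Antitone (remGame E S1 p) :=
  antitone_nat_of_succ_le fun _ _ h => h.1

theorem att_uniform [Fintype S] (C : Set S) (i : ℕ) (s : S)
    (h : ∀ t, E s t → t ∈ C → ∃ n, t ∈ attLayer E S1 p C i n) :
    ∃ n, ∀ t, E s t → t ∈ C → t ∈ attLayer E S1 p C i n := by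
  choose! f hf using h
  refine ⟨Finset.univ.sup f, fun t h1 h2 => ?_⟩
  exact attLayer_mono E S1 p C i (Finset.le_sup (f := f) (Finset.mem_univ t)) (hf t h1 h2)

theorem remGame_sub [Fintype S] (hE : ∀ s, ∃ t, E s t) (i : ℕ) :
    ∀ s ∈ remGame E S1 p i, ∃ t ∈ remGame E S1 p i, E s t := by
  induction i with
  | zero =>
    intro s _
    obtain ⟨t, ht⟩ := hE s
    exact ⟨t, trivial, ht⟩
  | succ i ih =>
    intro s hs
    obtain ⟨hs1, hs2⟩ := hs
    by_cases ho : s ∈ ownSet S1 i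
    · obtain ⟨t, ht, hst⟩ := ih s hs1
      exact ⟨t, ⟨ht, fun n hn => hs2 (n + 1) (Or.inr ⟨hs1, Or.inl ⟨ho, t, hst, hn⟩⟩)⟩, hst⟩
    · by_contra hcon
      obtain ⟨n, hn⟩ := att_uniform E S1 p (remGame E S1 p i) i s (by
        intro t h1 h2
        by_contra h3
        exact hcon ⟨t, ⟨h2, fun n hn => h3 ⟨n, hn⟩⟩, h1⟩)
      exact hs2 (n + 1) (Or.inr ⟨hs1, Or.inr ⟨ho, hn⟩⟩)

theorem remGame_le (i : ℕ) : ∀ s ∈ remGame E S1 p i, i ≤ p s := by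
  induction i with
  | zero => intro s _; exact Nat.zero_le _
  | succ i ih =>
    intro s hs
    have h1 := ih s hs.1
    have h2 : p s ≠ i := fun h => hs.2 0 ⟨hs.1, h⟩
    omega

theorem exists_idx [Fintype S] (hE : ∀ s, ∃ t, E s t) :
    ∃ idx rk : S → ℕ, (∀ s, idx s ≤ p s) ∧
      (∀ s t, E s t → idx t < idx s → s ∉ ownSet S1 (idx t)) ∧
      (∀ s, ∃ t, E s t ∧ idx s ≤ idx t) ∧
      (∀ s, s ∈ ownSet S1 (idx s) → p s ≠ idx s →
        ∃ t, E s t ∧ idx t = idx s ∧ rk t < rk s) ∧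
      (∀ s t, s ∉ ownSet S1 (idx s) → p s ≠ idx s → E s t →
        idx t < idx s ∨ (idx t = idx s ∧ rk t < rk s)) := by
  have hex : ∀ s, ∃ i, s ∈ remGame E S1 p i ∧ s ∉ remGame E S1 p (i + 1) := by
    intro s
    by_contra hcon
    push Not at hcon
    have : ∀ i, s ∈ remGame E S1 p i := by
      intro i
      induction i with
      | zero => trivial
      | succ i ih => exact hcon i ih
    have := remGame_le E S1 p _ s (this (p s + 1))
    omega
  choose idx hidx using hex
  have hge : ∀ s i, s ∈ remGame E S1 p i ↔ i ≤ idx s := by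
    intro s i
    constructor
    · intro h
      by_contra hlt
      exact (hidx s).2 (remGame_anti E S1 p (by omega : idx s + 1 ≤ i) h)
    · intro h
      exact remGame_anti E S1 p h (hidx s).1
  have hatt : ∀ s, ∃ n, s ∈ attLayer E S1 p (remGame E S1 p (idx s)) (idx s) n := by
    intro s
    by_contra hcon
    exact (hidx s).2 ⟨(hidx s).1, fun n hn => hcon ⟨n, hn⟩⟩
  have hatt_idx : ∀ s i n, s ∈ attLayer E S1 p (remGame E S1 p i) i n → idx s = i := by
    intro s i n h
    have h1 := (hge s i).1 (attLayer_sub E S1 p _ _ _ h)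
    by_contra hne
    exact ((hge s (i + 1)).2 (by omega)).2 n h
  have hrk : ∀ s i n, s ∈ attLayer E S1 p (remGame E S1 p i) i n →
      idx s = i ∧ Nat.find (hatt s) ≤ n := by
    intro s i n h
    have := hatt_idx s i n h
    subst this
    exact ⟨rfl, Nat.find_min' _ h⟩
  have hstep : ∀ s, p s ≠ idx s → ∃ n, Nat.find (hatt s) = n + 1 ∧
      ((s ∈ ownSet S1 (idx s) ∧
        ∃ t, E s t ∧ t ∈ attLayer E S1 p (remGame E S1 p (idx s)) (idx s) n) ∨
      (s ∉ ownSet S1 (idx s) ∧ ∀ t, E s t → t ∈ remGame E S1 p (idx s) →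
        t ∈ attLayer E S1 p (remGame E S1 p (idx s)) (idx s) n)) := by
    intro s hp
    have hspec := Nat.find_spec (hatt s)
    rcases hn : Nat.find (hatt s) with _ | n
    · rw [hn] at hspec
      exact absurd hspec.2 hp
    · rw [hn] at hspec
      refine ⟨n, rfl, ?_⟩
      rcases hspec with h | h
      · exact absurd h (Nat.find_min (hatt s) (by omega))
      · exact h.2
  refine ⟨idx, fun s => Nat.find (hatt s), ?_, ?_, ?_, ?_, ?_⟩
  · intro s
    exact remGame_le E S1 p _ s (hidx s).1
  · intro s t hst hlt ho
    obtain ⟨n, hn⟩ := hatt t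
    have := hatt_idx s (idx t) (n + 1)
      (Or.inr ⟨(hge s (idx t)).2 hlt.le, Or.inl ⟨ho, t, hst, hn⟩⟩)
    omega
  · intro s
    obtain ⟨t, ht, hst⟩ := remGame_sub E S1 p hE (idx s) s (hidx s).1
    exact ⟨t, hst, (hge t _).1 ht⟩
  · intro s ho hp
    obtain ⟨n, hn, h | h⟩ := hstep s hp
    · obtain ⟨_, t, hst, ht⟩ := h
      have := hrk t _ n ht
      exact ⟨t, hst, this.1, by have := this.2; show Nat.find _ < Nat.find _; omega⟩
    · exact absurd ho h.1
  · intro s t ho hp hst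
    obtain ⟨n, hn, h | h⟩ := hstep s hp
    · exact absurd h.1 ho
    · by_cases hlt : idx t < idx s
      · exact Or.inl hlt
      · have := hrk t _ n (h.2 t hst ((hge t _).2 (by omega)))
        exact Or.inr ⟨this.1, by have := this.2; show Nat.find _ < Nat.find _; omega⟩

theorem run_parity (idx rk : S → ℕ) (b : ℕ) (ω : ℕ → S)
    (h3 : ∀ s, idx s ≤ p s) (h0 : idx (ω 0) % 2 = b)
    (h1 : ∀ n, idx (ω (n + 1)) < idx (ω n) → idx (ω (n + 1)) % 2 = b)
    (h2 : ∀ n, idx (ω n) % 2 = b → p (ω n) ≠ idx (ω n) →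
      idx (ω (n + 1)) < idx (ω n) ∨
        (idx (ω (n + 1)) = idx (ω n) ∧ rk (ω (n + 1)) < rk (ω n))) :
    sInf (p '' Set.range ω) % 2 = b := by
  have hex : ∃ k, ∃ n, idx (ω n) = k := ⟨_, 0, rfl⟩
  set k := Nat.find hex with hk
  have hmin : ∀ n, k ≤ idx (ω n) := fun n => Nat.find_min' hex ⟨n, rfl⟩
  have hkn : ∃ n, idx (ω n) = k := Nat.find_spec hex
  have hkb : k % 2 = b := by
    have hspec := Nat.find_spec hkn
    rcases hm : Nat.find hkn with _ | m
    · rw [hm] at hspec; rw [← hspec]; exact h0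
    · rw [hm] at hspec
      have hne := Nat.find_min hkn (m := m) (by omega)
      have := hmin m
      rw [← hspec]
      exact h1 m (by omega)
  have hreach : ∀ r n, rk (ω n) ≤ r → idx (ω n) = k → ∃ m, p (ω m) = k := by
    intro r
    induction r with
    | zero =>
      intro n hr hn
      by_contra hcon
      have := h2 n (by rw [hn]; exact hkb) (fun h => hcon ⟨n, by omega⟩)
      have := hmin (n + 1)
      omega
    | succ r ih =>
      intro n hr hn
      by_contra hcon
      have := h2 n (by rw [hn]; exact hkb) (fun h => hcon ⟨n, by omega⟩)
      have := hmin (n + 1)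
      exact hcon (ih (n + 1) (by omega) (by omega))
  obtain ⟨n, hn⟩ := hkn
  obtain ⟨m, hm⟩ := hreach _ n le_rfl hn
  have : sInf (p '' Set.range ω) = k := by
    apply le_antisymm
    · exact Nat.sInf_le ⟨ω m, ⟨m, rfl⟩, hm⟩
    · apply le_csInf
      · exact ⟨_, ω m, ⟨m, rfl⟩, rfl⟩
      · rintro _ ⟨_, ⟨j, rfl⟩, rfl⟩
        exact (hmin j).trans (h3 _)
  rw [this]
  exact hkb

theorem exists_memoryless [Fintype S] (hE : ∀ s, ∃ t, E s t) :
    ∃ idx : S → ℕ, ∀ b < 2, ∃ f : S → S, (∀ s, E s (f s)) ∧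
      ∀ ω : ℕ → S, (∀ n, E (ω n) (ω (n + 1))) →
        (∀ n, ω n ∈ ownSet S1 b → ω (n + 1) = f (ω n)) →
        idx (ω 0) % 2 = b → sInf (p '' Set.range ω) % 2 = b := by
  obtain ⟨idx, rk, h3, hN, hS, hO, hO'⟩ := exists_idx E S1 p hE
  refine ⟨idx, fun b hb => ?_⟩
  have hown : ∀ s i, i % 2 = b → (s ∈ ownSet S1 i ↔ s ∈ ownSet S1 b) := by
    intro s i hi
    simp only [ownSet, Set.mem_setOf_eq, hi, Nat.mod_eq_of_lt hb]
  have hnown : ∀ s i, i % 2 ≠ b → (s ∉ ownSet S1 i ↔ s ∈ ownSet S1 b) := by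
    intro s i hi
    have : i % 2 = 0 ↔ ¬ b % 2 = 0 := by omega
    simp only [ownSet, Set.mem_setOf_eq, this]
    tauto
  have hf : ∀ s, ∃ t, E s t ∧ idx s ≤ idx t ∧ (s ∈ ownSet S1 b → idx s % 2 = b →
      p s ≠ idx s → idx t = idx s ∧ rk t < rk s) := by
    intro s
    by_cases hc : s ∈ ownSet S1 b ∧ idx s % 2 = b ∧ p s ≠ idx s
    · obtain ⟨t, h1, h2, h4⟩ := hO s ((hown s _ hc.2.1).2 hc.1) hc.2.2
      exact ⟨t, h1, h2.ge, fun _ _ _ => ⟨h2, h4⟩⟩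
    · obtain ⟨t, h1, h2⟩ := hS s
      exact ⟨t, h1, h2, fun a b c => absurd ⟨a, b, c⟩ hc⟩
  choose f hf1 hf2 hf4 using hf
  refine ⟨f, hf1, fun ω hω hωf h0 => run_parity p idx rk b ω h3 h0 ?_ ?_⟩
  · intro n hlt
    by_contra hne
    have hb := (hnown (ω n) _ hne).1 (hN _ _ (hω n) hlt)
    have := hf2 (ω n)
    rw [← hωf n hb] at this
    omega
  · intro n hpar hp
    by_cases hb : ω n ∈ ownSet S1 b
    · rw [hωf n hb]
      exact Or.inr (hf4 _ hb hpar hp)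
    · exact hO' _ _ (fun h => hb ((hown _ _ hpar).1 h)) hp (hω n)

end aux

/-- Player 1 has a single memoryless strategy `σ : S₁ → S`
(with `σ(s) ∈ E(s)` for all `s ∈ S₁`) that is winning for `WeakParityEven(p)`
from every state of the winning set `W₁ᴳ(WeakParityEven(p))`. -/
theorem weak_parity_memoryless_player_one {S : Type} [Fintype S]
    (E : S → S → Prop) (S1 : Set S) (hE : ∀ s, ∃ t, E s t)
    (d : ℕ) (p : S → ℕ) (hp : ∀ s, p s < d) :
    ∃ σm : S → S, (∀ s ∈ S1, E s (σm s)) ∧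
      ∀ s ∈ W1 Set.univ E S1 (WeakParityEven p),
        ∀ π, Strategy2 Set.univ E S1 π →
          play S1 (fun _ t => σm t) π s ∈ WeakParityEven p := by
  obtain ⟨idx, hidx⟩ := exists_memoryless E S1 p hE
  obtain ⟨f, hf, hfw⟩ := hidx 0 (by omega)
  obtain ⟨g, hg, hgw⟩ := hidx 1 (by omega)
  have hEplay : ∀ (σ π : List S → S → S) (s : S), Strategy1 Set.univ E S1 σ →
      Strategy2 Set.univ E S1 π → ∀ n, E (play S1 σ π s n) (play S1 σ π s (n + 1)) := by
    intro σ π s h1 h2 n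
    simp only [play, playAux]
    split_ifs with h
    · exact (h1 _ _ trivial h).1
    · exact (h2 _ _ trivial h).1
  refine ⟨f, fun s _ => hf s, ?_⟩
  rintro s ⟨_, σ, hσ, hwin⟩ π hπ
  have hev : idx s % 2 = 0 := by
    by_contra hodd
    have h2 : Strategy2 Set.univ E S1 (fun _ t => g t) := fun _ t _ _ => ⟨hg t, trivial⟩
    have hw := hwin _ h2
    have := hgw (play S1 σ (fun _ t => g t) s) (hEplay _ _ s hσ h2) (by
      intro n hn
      have hn' : play S1 σ (fun _ t => g t) s n ∉ S1 := by
        simpa [ownSet] using hn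
      simp only [play, playAux] at hn' ⊢
      rw [if_neg hn']) (by show idx s % 2 = 1; omega)
    have hw' := Nat.even_iff.1 hw
    omega
  have h1 : Strategy1 Set.univ E S1 (fun _ t => f t) := fun _ t _ _ => ⟨hf t, trivial⟩
  refine Nat.even_iff.2 (hfw (play S1 (fun _ t => f t) π s) (hEplay _ _ s h1 hπ) ?_ hev)
  intro n hn
  have hn' : play S1 (fun _ t => f t) π s n ∈ S1 := by
    simpa [ownSet] using hn
  simp only [play, playAux] at hn' ⊢
  rw [if_pos hn']
end

section
/- Let G = ((S,E),(S₁,S₂)) be a game graph and p : S → {0,…,d−1} a priority function, and define G⁰ = G, A_i = Attr_{(i mod 2)+1}(p⁻¹(i) ∩ S^i, G^i), G^{i+1} = G^i restricted to S^{i+1} = S^i \ A_i as in the classical algorithm, and let W₁^i = ⋃{A_j | j < i, j even}, W₂^i = ⋃{A_j | j < i, j odd}. Then for every 0 ≤ i ≤ d: W₁^i ⊆ W₁^G(WeakParityEven(p) ∩ {ω | min p(Occur(ω)) < i}) and W₂^i ⊆ W₂^G(WeakParityOdd(p) ∩ {ω | min p(Occur(ω)) < i}). -/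
open scoped Classical

/-- The inductive attractor computation for player 1:
`R₀ = U` and `R_{i+1} = R_i ∪ {s ∈ S₁ ∣ E(s) ∩ R_i ≠ ∅} ∪ {s ∈ S₂ ∣ E(s) ⊆ R_i}`. -/
def Rseq {S : Type} (E : S → S → Prop) (S1 : Set S) (U : Set S) : ℕ → Set S
  | 0 => U
  | i + 1 =>
      Rseq E S1 U i ∪ {s | s ∈ S1 ∧ ∃ t ∈ Rseq E S1 U i, E s t} ∪
        {s | s ∉ S1 ∧ ∀ t, E s t → t ∈ Rseq E S1 U i}

/-- One step of the classical algorithm: the attractor, inside the sub-game with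
carrier `C`, for player `(i mod 2) + 1` to the set of states of priority `i` in `C`. -/
noncomputable def attrStep {S : Type} (E : S → S → Prop) (S1 : Set S) (p : S → ℕ)
    (C : Set S) (i : ℕ) : Set S :=
  if Even i then Attr1 C E S1 ((p ⁻¹' {i}) ∩ C)
  else Attr2 C E S1 ((p ⁻¹' {i}) ∩ C)

/-- The state space `Sⁱ` of the sub-game `Gⁱ` in the classical algorithm:
`S⁰ = S` and `S^{i+1} = Sⁱ \ Aᵢ`. -/
noncomputable def algoS {S : Type} (E : S → S → Prop) (S1 : Set S) (p : S → ℕ) :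
    ℕ → Set S
  | 0 => Set.univ
  | i + 1 => algoS E S1 p i \ attrStep E S1 p (algoS E S1 p i) i

/-- The attractor set `Aᵢ = Attr_{(i mod 2)+1}(p⁻¹(i) ∩ Sⁱ, Gⁱ)` of the classical
algorithm. -/
noncomputable def algoA {S : Type} (E : S → S → Prop) (S1 : Set S) (p : S → ℕ)
    (i : ℕ) : Set S :=
  attrStep E S1 p (algoS E S1 p i) i

/-! ### Helper material -/

/-- Stages of the attractor for the player owning `P`, inside the carrier `C`. -/
def RS {S : Type} (C : Set S) (E : S → S → Prop) (P : Set S) (U : Set S) : ℕ → Set S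
  | 0 => U
  | n + 1 => RS C E P U n ∪ {s | s ∈ C ∧ s ∈ P ∧ ∃ t ∈ RS C E P U n, E s t} ∪
      {s | s ∈ C ∧ s ∉ P ∧ ∀ t ∈ C, E s t → t ∈ RS C E P U n}

/-- The attractor as union of its stages. -/
def RU {S : Type} (C : Set S) (E : S → S → Prop) (P : Set S) (U : Set S) : Set S :=
  {s | ∃ n, s ∈ RS C E P U n}

theorem RS_mono {S : Type} (C : Set S) (E : S → S → Prop) (P : Set S) (U : Set S) :
    Monotone (RS C E P U) :=
  monotone_nat_of_le_succ (fun _ _ hs => Or.inl (Or.inl hs))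

theorem RS_sub {S : Type} (C : Set S) (E : S → S → Prop) (P : Set S) (U : Set S)
    (hU : U ⊆ C) (n : ℕ) : RS C E P U n ⊆ C := by
  induction n with
  | zero => exact hU
  | succ n ih =>
    rintro s ((h | h) | h)
    · exact ih h
    · exact h.1
    · exact h.1

theorem RU_sub {S : Type} (C : Set S) (E : S → S → Prop) (P : Set S) (U : Set S)
    (hU : U ⊆ C) : RU C E P U ⊆ C := fun _ ⟨n, hn⟩ => RS_sub C E P U hU n hn

theorem RU_own {S : Type} {C : Set S} {E : S → S → Prop} {P : Set S} {U : Set S}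
    {s t : S} (hs : s ∈ C) (hP : s ∈ P) (ht : t ∈ RU C E P U) (he : E s t) :
    s ∈ RU C E P U := by
  obtain ⟨n, hn⟩ := ht
  exact ⟨n + 1, Or.inl (Or.inr ⟨hs, hP, t, hn, he⟩)⟩

theorem RU_opp {S : Type} [Fintype S] {C : Set S} {E : S → S → Prop} {P : Set S} {U : Set S}
    {s : S} (hs : s ∈ C) (hP : s ∉ P) (h : ∀ t ∈ C, E s t → t ∈ RU C E P U) :
    s ∈ RU C E P U := by
  have h' : ∀ t, ∃ n, t ∈ C → E s t → t ∈ RS C E P U n := by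
    intro t
    by_cases h1 : t ∈ C ∧ E s t
    · obtain ⟨n, hn⟩ := h t h1.1 h1.2
      exact ⟨n, fun _ _ => hn⟩
    · exact ⟨0, fun a b => absurd ⟨a, b⟩ h1⟩
  choose f hf using h'
  refine ⟨Finset.univ.sup f + 1, Or.inr ⟨hs, hP, fun t ht he => ?_⟩⟩
  exact RS_mono C E P U (Finset.le_sup (f := f) (Finset.mem_univ t)) (hf t ht he)

theorem tot_diff {S : Type} [Fintype S] {C : Set S} {E : S → S → Prop} {P : Set S} {U : Set S}
    (htot : ∀ s ∈ C, ∃ t ∈ C, E s t) :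
    ∀ s ∈ C \ RU C E P U, ∃ t ∈ C \ RU C E P U, E s t := by
  rintro s ⟨hs, hn⟩
  by_cases hP : s ∈ P
  · obtain ⟨t, ht, he⟩ := htot s hs
    exact ⟨t, ⟨ht, fun h => hn (RU_own hs hP h he)⟩, he⟩
  · by_contra hc
    apply hn
    refine RU_opp hs hP (fun t ht he => ?_)
    by_contra h
    exact hc ⟨t, ⟨ht, h⟩, he⟩

theorem play_own {S : Type} {S1 : Set S} {σ π : List S → S → S} {s : S} {n : ℕ}
    (h : play S1 σ π s n ∈ S1) :
    play S1 σ π s (n + 1) = σ (playAux S1 σ π s n).1 (play S1 σ π s n) := by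
  exact if_pos h

theorem play_opp {S : Type} {S1 : Set S} {σ π : List S → S → S} {s : S} {n : ℕ}
    (h : play S1 σ π s n ∉ S1) :
    play S1 σ π s (n + 1) = π (playAux S1 σ π s n).1 (play S1 σ π s n) := by
  exact if_neg h

theorem playAux_compl {S : Type} (S1 : Set S) (σ π : List S → S → S) (s : S) (n : ℕ) :
    playAux S1 σ π s n = playAux S1ᶜ π σ s n := by
  induction n with
  | zero => rfl
  | succ n ih =>
    simp only [playAux, ih, Set.mem_compl_iff, ite_not]

theorem W2_eq {S : Type} (C : Set S) (E : S → S → Prop) (S1 : Set S) (Ψ : Set (ℕ → S)) :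
    W2 C E S1 Ψ = W1 C E S1ᶜ Ψ := by
  have hp : ∀ σ π s, play S1 σ π s = play S1ᶜ π σ s := by
    intro σ π s
    funext n
    simp only [play, playAux_compl S1 σ π s n]
  simp only [W1, W2, Strategy1, Strategy2, hp, Set.mem_compl_iff, not_not]

/-- Rank-decreasing choices. -/
theorem W1_reach {S : Type} [Fintype S] {C : Set S} {E : S → S → Prop} {P : Set S} {U : Set S}
    (hU : U ⊆ C) (htot : ∀ s ∈ C, ∃ t ∈ C, E s t) :
    W1 C E P (Reach U) = RU C E P U := by
  have hσ : ∀ s, ∃ t, s ∈ C → (E s t ∧ t ∈ C ∧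
      (s ∈ P → ∀ n, s ∈ RS C E P U (n + 1) → s ∉ RS C E P U n → t ∈ RS C E P U n)) := by
    intro s
    by_cases hs : s ∈ C
    · by_cases hn : s ∈ P ∧ ∃ n, s ∈ RS C E P U (n + 1) ∧ s ∉ RS C E P U n
      · obtain ⟨hP, n, h1, h2⟩ := hn
        rcases h1 with (h1 | h1) | h1
        · exact absurd h1 h2
        · obtain ⟨_, _, t, ht, he⟩ := h1
          refine ⟨t, fun _ => ⟨he, RS_sub C E P U hU n ht, fun _ m hm1 hm2 => ?_⟩⟩
          apply RS_mono C E P U _ ht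
          by_contra hlt
          exact h2 (RS_mono C E P U (by omega) hm1)
        · exact absurd hP h1.2.1
      · obtain ⟨t, ht, he⟩ := htot s hs
        exact ⟨t, fun _ => ⟨he, ht, fun hP n h1 h2 => absurd ⟨hP, n, h1, h2⟩ hn⟩⟩
    · exact ⟨s, fun h => absurd h hs⟩
  choose f hf using hσ
  ext s
  constructor
  · rintro ⟨hs, σ, hσ, hwin⟩
    by_contra hn
    have hg : ∀ s, ∃ t, s ∈ C → (E s t ∧ t ∈ C ∧ (s ∉ RU C E P U → t ∉ RU C E P U)) := by
      intro s
      by_cases h : s ∈ C \ RU C E P U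
      · obtain ⟨t, ht, he⟩ := tot_diff htot s h
        exact ⟨t, fun _ => ⟨he, ht.1, fun _ => ht.2⟩⟩
      · by_cases hs : s ∈ C
        · obtain ⟨t, ht, he⟩ := htot s hs
          exact ⟨t, fun _ => ⟨he, ht, fun h' => absurd ⟨hs, h'⟩ h⟩⟩
        · exact ⟨s, fun h => absurd h hs⟩
    choose g hg using hg
    obtain ⟨k, hk⟩ := hwin (fun _ s => g s) (fun _ s hs _ => ⟨(hg s hs).1, (hg s hs).2.1⟩)
    have inv : ∀ k, play P σ (fun _ s => g s) s k ∈ C \ RU C E P U := by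
      intro k
      induction k with
      | zero => exact ⟨hs, hn⟩
      | succ k ih =>
        by_cases hP : play P σ (fun _ s => g s) s k ∈ P
        · rw [play_own hP]
          have := hσ (playAux P σ (fun _ s => g s) s k).1 _ ih.1 hP
          exact ⟨this.2, fun h => ih.2 (RU_own ih.1 hP h this.1)⟩
        · rw [play_opp hP]
          exact ⟨(hg _ ih.1).2.1, (hg _ ih.1).2.2 ih.2⟩
    exact (inv k).2 ⟨0, hk⟩
  · intro hs
    refine ⟨RU_sub C E P U hU hs, fun _ s => f s,
      fun _ s hs _ => ⟨(hf s hs).1, (hf s hs).2.1⟩, fun π hπ => ?_⟩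
    have key : ∀ n k, play P (fun _ s => f s) π s k ∈ RS C E P U n →
        ∃ k', play P (fun _ s => f s) π s k' ∈ U := by
      intro n
      induction n with
      | zero => exact fun k hk => ⟨k, hk⟩
      | succ n ih =>
        intro k hk
        by_cases hn : play P (fun _ s => f s) π s k ∈ RS C E P U n
        · exact ih k hn
        have hC := RS_sub C E P U hU _ hk
        apply ih (k + 1)
        by_cases hP : play P (fun _ s => f s) π s k ∈ P
        · rw [play_own hP]
          exact (hf _ hC).2.2 hP n hk hn
        · rw [play_opp hP]
          rcases hk with (h | h) | h
          · exact absurd h hn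
          · exact absurd h.2.1 hP
          · have := hπ (playAux P (fun _ s => f s) π s k).1 _ hC hP
            exact h.2.2 _ this.2 this.1
    obtain ⟨n, hn⟩ := hs
    exact key n 0 hn

theorem core {S : Type} [Fintype S] (E : S → S → Prop) (P : Set S) (d : ℕ) (p : S → ℕ)
    (hp : ∀ s, p s < d) (par : ℕ → Prop) (C A : ℕ → Set S)
    (h0 : C 0 = Set.univ) (hsucc : ∀ j, C (j + 1) = C j \ A j)
    (htot : ∀ j, ∀ s ∈ C j, ∃ t ∈ C j, E s t)
    (hA : ∀ j, par j → A j = RU (C j) E P (p ⁻¹' {j} ∩ C j))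
    (hAn : ∀ j, ¬ par j → A j = RU (C j) E Pᶜ (p ⁻¹' {j} ∩ C j))
    (j : ℕ) (hj : par j) :
    A j ⊆ W1 Set.univ E P {ω | ∃ m ≤ j, par m ∧ sInf (p '' Set.range ω) = m} := by
  have hanti : Antitone C := antitone_nat_of_succ_le (fun n => by
    rw [hsucc]; exact Set.diff_subset)
  have hAC : ∀ j, A j ⊆ C j := by
    intro j
    by_cases h : par j
    · rw [hA j h]; exact RU_sub _ _ _ _ Set.inter_subset_right
    · rw [hAn j h]; exact RU_sub _ _ _ _ Set.inter_subset_right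
  have hpA : ∀ s, s ∈ C (p s) → s ∈ A (p s) := by
    intro s hs
    by_cases h : par (p s)
    · rw [hA _ h]; exact ⟨0, rfl, hs⟩
    · rw [hAn _ h]; exact ⟨0, rfl, hs⟩
  have hCp : ∀ j s, s ∈ C j → j ≤ p s := by
    intro j s hs
    by_contra hlt
    have h1 : s ∈ C (p s + 1) := hanti (by omega) hs
    have h2 : s ∈ C (p s) := hanti (by omega) hs
    rw [hsucc] at h1
    exact h1.2 (hpA s h2)
  have hlev : ∀ s, ∃ l, s ∈ A l := by
    intro s
    by_contra hc
    push Not at hc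
    have : ∀ j, s ∈ C j := by
      intro j
      induction j with
      | zero => rw [h0]; trivial
      | succ j ih => rw [hsucc]; exact ⟨ih, hc j⟩
    have := hCp d s (this d)
    have := hp s
    omega
  choose lev hlev using hlev
  have hClev : ∀ s j, s ∈ C j ↔ j ≤ lev s := by
    intro s j
    constructor
    · intro h
      by_contra hlt
      have h1 : s ∈ C (lev s + 1) := hanti (by omega) h
      rw [hsucc] at h1
      exact h1.2 (hlev s)
    · intro h
      exact hanti h (hAC _ (hlev s))
  have hAlev : ∀ s j, s ∈ A j → j = lev s := by
    intro s j h
    have h1 := (hClev s j).1 (hAC j h)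
    by_contra hne
    have h2 := (hClev s (j + 1)).2 (by omega)
    rw [hsucc] at h2
    exact h2.2 h
  let R : ℕ → ℕ → Set S := fun j => RS (C j) E P (p ⁻¹' {j} ∩ C j)
  -- the positional strategy
  have hσ : ∀ s, ∃ t, E s t ∧ lev s ≤ lev t ∧
      (s ∈ P → ∀ n, s ∈ R (lev s) (n + 1) → s ∉ R (lev s) n → t ∈ R (lev s) n) := by
    intro s
    have hs : s ∈ C (lev s) := (hClev s _).2 le_rfl
    by_cases hn : s ∈ P ∧ ∃ n, s ∈ R (lev s) (n + 1) ∧ s ∉ R (lev s) n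
    · obtain ⟨hP, n, h1, h2⟩ := hn
      rcases h1 with (h1 | h1) | h1
      · exact absurd h1 h2
      · obtain ⟨_, _, t, ht, he⟩ := h1
        refine ⟨t, he, (hClev t _).1 (RS_sub _ E P _ Set.inter_subset_right n ht),
          fun _ m hm1 hm2 => ?_⟩
        apply RS_mono _ E P _ _ ht
        by_contra hlt
        exact h2 (RS_mono _ E P _ (by omega) hm1)
      · exact absurd hP h1.2.1
    · obtain ⟨t, ht, he⟩ := htot _ s hs
      exact ⟨t, he, (hClev t _).1 ht, fun hP n h1 h2 => absurd ⟨hP, n, h1, h2⟩ hn⟩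
  choose f hf using hσ
  intro s hs
  refine ⟨trivial, fun _ s => f s, fun _ s _ _ => ⟨(hf s).1, trivial⟩, fun π hπ => ?_⟩
  generalize hω : play P (fun _ s => f s) π s = ω
  have hown : ∀ n, ω n ∈ P → ω (n + 1) = f (ω n) := by
    subst hω
    intro n hn
    rw [play_own hn]
  have hopp : ∀ n, ω n ∉ P → E (ω n) (ω (n + 1)) := by
    subst hω
    intro n hn
    rw [play_opp hn]
    exact (hπ _ _ trivial hn).1
  have hz : ω 0 = s := by subst hω; rfl
  -- minimal level along the play
  have hex : ∃ m, ∃ k, lev (ω k) = m := ⟨_, 0, rfl⟩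
  obtain ⟨m, ⟨k, hk⟩, hmin⟩ : ∃ m, (∃ k, lev (ω k) = m) ∧ ∀ k, m ≤ lev (ω k) :=
    ⟨Nat.find hex, Nat.find_spec hex, fun k => Nat.find_min' hex ⟨k, rfl⟩⟩
  have hj0 : lev (ω 0) = j := by rw [hz]; exact (hAlev s j hs).symm
  have hmj : m ≤ j := hj0 ▸ hmin 0
  have hdrop : ∀ n, ¬ par (lev (ω (n + 1))) → lev (ω n) ≤ lev (ω (n + 1)) := by
    intro n hn
    by_cases hP : ω n ∈ P
    · rw [hown n hP]; exact (hf _).2.1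
    · by_contra hlt
      have h1 : ω n ∈ C (lev (ω (n + 1))) := (hClev _ _).2 (by omega)
      have h2 := hlev (ω (n + 1))
      have h3 : ω n ∈ A (lev (ω (n + 1))) := by
        rw [hAn _ hn] at h2 ⊢
        exact RU_own h1 hP h2 (hopp n hP)
      have := hAlev _ _ h3
      omega
  have hpar : par m := by
    by_contra hnp
    have hall : ∀ k, lev (ω k) = m → lev (ω 0) = m := by
      intro k
      induction k with
      | zero => exact id
      | succ k ih =>
        intro hk
        apply ih
        have h1 := hdrop k (by rw [hk]; exact hnp)
        have h2 := hmin k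
        omega
    have := hall k hk
    rw [hj0] at this
    exact hnp (this ▸ hj)
  have key : ∀ n k, ω k ∈ R m n → ∃ k', p (ω k') = m := by
    intro n
    induction n with
    | zero => exact fun k hk => ⟨k, hk.1⟩
    | succ n ih =>
      intro k hk
      by_cases hn : ω k ∈ R m n
      · exact ih k hn
      have hl : m = lev (ω k) := by
        apply hAlev
        rw [hA m hpar]
        exact ⟨n + 1, hk⟩
      apply ih (k + 1)
      by_cases hP : ω k ∈ P
      · rw [hown k hP]
        have := (hf (ω k)).2.2 hP n
        rw [← hl] at this
        exact this hk hn
      · rcases hk with (h | h) | h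
        · exact absurd h hn
        · exact absurd h.2.1 hP
        · exact h.2.2 _ ((hClev _ _).2 (hmin _)) (hopp k hP)
  have hkA : ω k ∈ A m := hk ▸ hlev (ω k)
  rw [hA m hpar] at hkA
  obtain ⟨n, hn⟩ := hkA
  obtain ⟨k', hk'⟩ := key n k hn
  refine ⟨m, hmj, hpar, le_antisymm ?_ ?_⟩
  · exact Nat.sInf_le ⟨_, ⟨k', rfl⟩, hk'⟩
  · refine le_csInf ⟨_, _, ⟨0, rfl⟩, rfl⟩ ?_
    rintro _ ⟨_, ⟨a, rfl⟩, rfl⟩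
    exact (hmin a).trans (hCp _ _ ((hClev _ _).2 le_rfl))

theorem W1_mono {S : Type} (C : Set S) (E : S → S → Prop) (P : Set S) {Φ Ψ : Set (ℕ → S)}
    (h : Φ ⊆ Ψ) : W1 C E P Φ ⊆ W1 C E P Ψ :=
  fun _ ⟨hs, σ, hσ, hw⟩ => ⟨hs, σ, hσ, fun π hπ => h (hw π hπ)⟩

theorem attrStep_eq {S : Type} [Fintype S] (E : S → S → Prop) (S1 : Set S) (p : S → ℕ)
    (C : Set S) (i : ℕ) (htot : ∀ s ∈ C, ∃ t ∈ C, E s t) :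
    attrStep E S1 p C i = RU C E (if Even i then S1 else S1ᶜ) (p ⁻¹' {i} ∩ C) := by
  unfold attrStep
  split_ifs
  · exact W1_reach Set.inter_subset_right htot
  · unfold Attr2
    rw [W2_eq]
    exact W1_reach Set.inter_subset_right htot

theorem algoS_tot {S : Type} [Fintype S] (E : S → S → Prop) (S1 : Set S)
    (hE : ∀ s, ∃ t, E s t) (p : S → ℕ) (j : ℕ) :
    ∀ s ∈ algoS E S1 p j, ∃ t ∈ algoS E S1 p j, E s t := by
  induction j with
  | zero =>
    intro s _
    obtain ⟨t, ht⟩ := hE s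
    exact ⟨t, trivial, ht⟩
  | succ j ih =>
    simp only [algoS]
    rw [attrStep_eq E S1 p _ j ih]
    exact tot_diff ih

/-- **Invariant of the classical algorithm.** For every `0 ≤ i ≤ d`,
`W₁ⁱ ⊆ W₁ᴳ(WeakParityEven(p) ∩ {ω ∣ min p(Occur(ω)) < i})` and
`W₂ⁱ ⊆ W₂ᴳ(WeakParityOdd(p) ∩ {ω ∣ min p(Occur(ω)) < i})`. -/
theorem algo_invariant {S : Type} [Fintype S]
    (E : S → S → Prop) (S1 : Set S) (hE : ∀ s, ∃ t, E s t)
    (d : ℕ) (p : S → ℕ) (hp : ∀ s, p s < d) :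
    ∀ i ≤ d,
      (⋃ j ∈ {j : ℕ | j < i ∧ Even j}, algoA E S1 p j) ⊆
        W1 Set.univ E S1
          (WeakParityEven p ∩ {ω | sInf (p '' Set.range ω) < i}) ∧
      (⋃ j ∈ {j : ℕ | j < i ∧ Odd j}, algoA E S1 p j) ⊆
        W2 Set.univ E S1
          (WeakParityOdd p ∩ {ω | sInf (p '' Set.range ω) < i}) := by
  have htot := algoS_tot E S1 hE p
  have hAeq : ∀ j, algoA E S1 p j = RU (algoS E S1 p j) E (if Even j then S1 else S1ᶜ)
      (p ⁻¹' {j} ∩ algoS E S1 p j) := fun j => attrStep_eq E S1 p _ j (htot j)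
  intro i _
  constructor
  · refine Set.iUnion₂_subset ?_
    rintro j ⟨hji, hj⟩
    refine (core E S1 d p hp Even (algoS E S1 p) (algoA E S1 p) rfl (fun _ => rfl) htot
      (fun k hk => ?_) (fun k hk => ?_) j hj).trans (W1_mono _ _ _ ?_)
    · rw [hAeq, if_pos hk]
    · rw [hAeq, if_neg hk]
    · rintro ω ⟨m, hm, hpm, h⟩
      refine ⟨?_, ?_⟩
      · change Even _
        rw [h]; exact hpm
      · change _ < i
        rw [h]; omega
  · refine Set.iUnion₂_subset ?_
    rintro j ⟨hji, hj⟩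
    rw [W2_eq]
    refine (core E S1ᶜ d p hp Odd (algoS E S1 p) (algoA E S1 p) rfl (fun _ => rfl) htot
      (fun k hk => ?_) (fun k hk => ?_) j hj).trans (W1_mono _ _ _ ?_)
    · rw [hAeq, if_neg (Nat.not_even_iff_odd.2 hk)]
    · rw [hAeq, if_pos (Nat.not_odd_iff_even.1 hk), compl_compl]
    · rintro ω ⟨m, hm, hpm, h⟩
      refine ⟨?_, ?_⟩
      · change Odd _
        rw [h]; exact hpm
      · change _ < i
        rw [h]; omega
end

section
/- Let G = ((S,E),(S₁,S₂)) be a game graph and p : S → {0,…,d−1} a priority function, and define G⁰ = G, A_i = Attr_{(i mod 2)+1}(p⁻¹(i) ∩ S^i, G^i), G^{i+1} = G^i restricted to S^{i+1} = S^i \ A_i as in the classical algorithm, and let W₁^i = ⋃{A_j | j < i, j even}. Then for every even i with 0 ≤ i < d and every state s ∈ A_i, there exists a player-1 strategy σ (the attractor strategy to p⁻¹(i) ∩ S^i in G^i, followed by choosing edges inside S^i) such that for every player-2 strategy π, the play ω(s,σ,π) belongs to (WeakParityEven(p) ∩ {ω | min p(Occur(ω)) ≤ i}) ∪ Reach(W₁^i).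 -/
open scoped Classical

theorem playAux_congr_of {S : Type} (S1 : Set S) (σ π σ' π' : List S → S → S) (s : S)
    (h1 : ∀ n, (playAux S1 σ π s n).2 ∈ S1 →
      σ (playAux S1 σ π s n).1 (playAux S1 σ π s n).2 =
      σ' (playAux S1 σ π s n).1 (playAux S1 σ π s n).2)
    (h2 : ∀ n, (playAux S1 σ π s n).2 ∉ S1 →
      π (playAux S1 σ π s n).1 (playAux S1 σ π s n).2 =
      π' (playAux S1 σ π s n).1 (playAux S1 σ π s n).2) :
    ∀ n, playAux S1 σ π s n = playAux S1 σ' π' s n := by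
  intro n
  induction n with
  | zero => rfl
  | succ n ih =>
    have e1 := h1 n
    have e2 := h2 n
    simp only [playAux]
    rw [← ih]
    by_cases h : (playAux S1 σ π s n).2 ∈ S1
    · simp only [if_pos h]; rw [e1 h]
    · simp only [if_neg h]; rw [e2 h]

theorem playAux_head {S : Type} (S1 : Set S) (σ π : List S → S → S) (s : S) (n : ℕ) :
    ((playAux S1 σ π s n).1 ++ [(playAux S1 σ π s n).2]).head? = some s := by
  induction n with
  | zero => rfl
  | succ n ih =>
    simp only [playAux]
    rw [List.head?_append, ih]; rfl

theorem playAux_shift {S : Type} (S1 : Set S) (σ π : List S → S → S) (s : S) (n : ℕ) :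
    playAux S1 σ π s (n + 1) =
      (s :: (playAux S1 (fun w => σ (s :: w)) (fun w => π (s :: w))
          (if s ∈ S1 then σ [] s else π [] s) n).1,
        (playAux S1 (fun w => σ (s :: w)) (fun w => π (s :: w))
          (if s ∈ S1 then σ [] s else π [] s) n).2) := by
  induction n with
  | zero => rfl
  | succ n ih =>
    rw [playAux]
    simp only [ih]
    simp only [playAux, List.cons_append]

theorem play_swap {S : Type} (S1 : Set S) (σ π : List S → S → S) (s : S) :
    play S1ᶜ π σ s = play S1 σ π s := by
  have : ∀ n, playAux S1ᶜ π σ s n = playAux S1 σ π s n := by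
    intro n
    induction n with
    | zero => rfl
    | succ n ih =>
      simp only [playAux, ih]
      by_cases h : (playAux S1 σ π s n).2 ∈ S1 <;> simp [h]
  funext n
  simp only [play, this]

theorem strat1_compl {S : Type} (C : Set S) (E : S → S → Prop) (S1 : Set S)
    (σ : List S → S → S) : Strategy1 C E S1ᶜ σ ↔ Strategy2 C E S1 σ := Iff.rfl

theorem strat2_compl {S : Type} (C : Set S) (E : S → S → Prop) (S1 : Set S)
    (σ : List S → S → S) : Strategy2 C E S1ᶜ σ ↔ Strategy1 C E S1 σ := by
  simp [Strategy1, Strategy2]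

theorem attr2_eq {S : Type} (C : Set S) (E : S → S → Prop) (S1 U : Set S) :
    Attr2 C E S1 U = Attr1 C E S1ᶜ U := by
  ext s
  simp only [Attr1, Attr2, W1, W2, strat1_compl, strat2_compl, play_swap]

theorem exists_strat {S : Type} (C : Set S) (E : S → S → Prop)
    (hC : ∀ s ∈ C, ∃ t ∈ C, E s t) :
    ∃ g : S → S, ∀ s ∈ C, E s (g s) ∧ g s ∈ C := by
  have : ∀ s, ∃ t, s ∈ C → E s t ∧ t ∈ C := by
    intro s
    by_cases h : s ∈ C
    · obtain ⟨t, h1, h2⟩ := hC s h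
      exact ⟨t, fun _ => ⟨h2, h1⟩⟩
    · exact ⟨s, fun h' => absurd h' h⟩
  choose g hg using this
  exact ⟨g, hg⟩

theorem attr1_base {S : Type} (C : Set S) (E : S → S → Prop) (S1 U : Set S)
    (hC : ∀ s ∈ C, ∃ t ∈ C, E s t) (s : S) (hs : s ∈ C) (hU : s ∈ U) :
    s ∈ Attr1 C E S1 U := by
  obtain ⟨g, hg⟩ := exists_strat C E hC
  exact ⟨hs, fun _ => g, fun _ u hu _ => hg u hu, fun π _ => ⟨0, hU⟩⟩

theorem attr1_step {S : Type} (C : Set S) (E : S → S → Prop) (S1 U : Set S)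
    (hC : ∀ s ∈ C, ∃ t ∈ C, E s t) (s : S) (hs : s ∈ C)
    (h1 : s ∈ S1 → ∃ t ∈ Attr1 C E S1 U, E s t)
    (h2 : s ∉ S1 → ∀ t ∈ C, E s t → t ∈ Attr1 C E S1 U) :
    s ∈ Attr1 C E S1 U := by
  obtain ⟨g, hg⟩ := exists_strat C E hC
  have hf : ∀ t, ∃ σ, Strategy1 C E S1 σ ∧ (t ∈ Attr1 C E S1 U →
      ∀ π, Strategy2 C E S1 π → play S1 σ π t ∈ Reach U) := by
    intro t
    by_cases h : t ∈ Attr1 C E S1 U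
    · obtain ⟨_, σ, h3, h4⟩ := h
      exact ⟨σ, h3, fun _ => h4⟩
    · exact ⟨fun _ => g, fun _ u hu _ => hg u hu, fun h' => absurd h' h⟩
  choose f hf1 hf2 using hf
  have hk : ∃ k : S → S, (∀ u ∈ C, E u (k u) ∧ k u ∈ C) ∧
      (s ∈ S1 → k s ∈ Attr1 C E S1 U) := by
    by_cases h : s ∈ S1
    · obtain ⟨t, ht, he⟩ := h1 h
      refine ⟨Function.update g s t, ?_, fun _ => by simpa using ht⟩
      intro u hu
      by_cases hus : u = s
      · subst hus; simpa using ⟨he, ht.1⟩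
      · simpa [Function.update_of_ne hus] using hg u hu
    · exact ⟨g, hg, fun h' => absurd h' h⟩
  obtain ⟨k, hk1, hk2⟩ := hk
  let σ : List S → S → S := fun w u => match w with
    | [] => k u
    | _ :: w' => f (((w' ++ [u]).head?).getD u) w' u
  refine ⟨hs, σ, ?_, ?_⟩
  · intro w u hu hu1
    cases w with
    | nil => exact hk1 u hu
    | cons a w' => exact hf1 _ w' u hu hu1
  · intro π hπ
    set t := if s ∈ S1 then σ [] s else π [] s with ht
    have htA : t ∈ Attr1 C E S1 U := by
      by_cases h : s ∈ S1
      · rw [ht, if_pos h]; exact hk2 h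
      · rw [ht, if_neg h]; exact h2 h _ (hπ [] s hs h).2 (hπ [] s hs h).1
    obtain ⟨n, hn⟩ := hf2 t htA (fun w => π (s :: w)) (fun w u => hπ (s :: w) u)
    refine ⟨n + 1, ?_⟩
    have key : ∀ n, playAux S1 (fun w => σ (s :: w)) (fun w => π (s :: w)) t n =
        playAux S1 (f t) (fun w => π (s :: w)) t n := by
      apply playAux_congr_of
      · intro n _
        have := playAux_head S1 (fun w => σ (s :: w)) (fun w => π (s :: w)) t n
        simp only [σ] at this ⊢
        rw [this]; rfl
      · intros; rfl
    simp only [play] at hn ⊢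
    rw [playAux_shift, ← ht, key]
    exact hn

theorem attr1_compl_total {S : Type} (C : Set S) (E : S → S → Prop) (S1 U : Set S)
    (hC : ∀ s ∈ C, ∃ t ∈ C, E s t) :
    ∀ s ∈ C \ Attr1 C E S1 U, ∃ t ∈ C \ Attr1 C E S1 U, E s t := by
  rintro s ⟨hs, hsA⟩
  by_contra hcon
  push Not at hcon
  have hall : ∀ t ∈ C, E s t → t ∈ Attr1 C E S1 U := by
    intro t ht he
    by_contra h
    exact hcon t ⟨ht, h⟩ he
  apply hsA
  apply attr1_step C E S1 U hC s hs
  · intro _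
    obtain ⟨t, ht, he⟩ := hC s hs
    exact ⟨t, hall t ht he, he⟩
  · intro _; exact hall

theorem algoS_total {S : Type} (E : S → S → Prop) (S1 : Set S) (hE : ∀ s, ∃ t, E s t)
    (p : S → ℕ) (i : ℕ) : ∀ s ∈ algoS E S1 p i, ∃ t ∈ algoS E S1 p i, E s t := by
  induction i with
  | zero => intro s _; obtain ⟨t, ht⟩ := hE s; exact ⟨t, trivial, ht⟩
  | succ i ih =>
    simp only [algoS, attrStep]
    split_ifs
    · exact attr1_compl_total _ E S1 _ ih
    · rw [attr2_eq]; exact attr1_compl_total _ E S1ᶜ _ ih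

theorem algoS_le {S : Type} (E : S → S → Prop) (S1 : Set S) (hE : ∀ s, ∃ t, E s t)
    (p : S → ℕ) (i : ℕ) : ∀ s ∈ algoS E S1 p i, i ≤ p s := by
  induction i with
  | zero => intro s _; exact Nat.zero_le _
  | succ i ih =>
    rintro s ⟨hs, hA⟩
    have h := ih s hs
    rcases Nat.lt_or_eq_of_le h with h | h
    · exact h
    · exfalso
      apply hA
      have hC := algoS_total E S1 hE p i
      simp only [attrStep]
      split_ifs
      · exact attr1_base _ E S1 _ hC s hs ⟨h.symm, hs⟩
      · rw [attr2_eq]; exact attr1_base _ E S1ᶜ _ hC s hs ⟨h.symm, hs⟩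

/-- A player-2 edge leaving `Sⁱ` goes to some `Aⱼ` with `j < i` even. -/
theorem algoS_escape {S : Type} (E : S → S → Prop) (S1 : Set S) (hE : ∀ s, ∃ t, E s t)
    (p : S → ℕ) (i : ℕ) : ∀ s ∈ algoS E S1 p i, s ∉ S1 → ∀ t, E s t →
      t ∉ algoS E S1 p i → ∃ j, (j < i ∧ Even j) ∧ t ∈ algoA E S1 p j := by
  induction i with
  | zero => intro s _ _ t _ ht; exact absurd trivial ht
  | succ i ih =>
    rintro s ⟨hs, hA⟩ hs1 t he ht
    by_cases hti : t ∈ algoS E S1 p i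
    · have htA : t ∈ attrStep E S1 p (algoS E S1 p i) i := by
        by_contra h
        exact ht ⟨hti, h⟩
      by_cases hi : Even i
      · exact ⟨i, ⟨Nat.lt_succ_self i, hi⟩, htA⟩
      · exfalso
        apply hA
        simp only [attrStep, if_neg hi] at htA ⊢
        rw [attr2_eq] at htA ⊢
        exact attr1_step _ E S1ᶜ _ (algoS_total E S1 hE p i) s hs
          (fun _ => ⟨t, htA, he⟩) (fun h => absurd hs1 h)
    · obtain ⟨j, ⟨hj, hje⟩, h⟩ := ih s hs hs1 t he hti
      exact ⟨j, ⟨Nat.lt_succ_of_lt hj, hje⟩, h⟩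

/-- For every even `i < d` and every `s ∈ Aᵢ`, there is a
player-1 strategy `σ` such that against every player-2 strategy `π` the play
`ω(s,σ,π)` belongs to
`(WeakParityEven(p) ∩ {ω ∣ min p(Occur(ω)) ≤ i}) ∪ Reach(W₁ⁱ)`. -/
theorem algo_attractor_strategy_even {S : Type} [Fintype S]
    (E : S → S → Prop) (S1 : Set S) (hE : ∀ s, ∃ t, E s t)
    (d : ℕ) (p : S → ℕ) (hp : ∀ s, p s < d) :
    ∀ i, i < d → Even i → ∀ s ∈ algoA E S1 p i,
      ∃ σ, Strategy1 Set.univ E S1 σ ∧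
        ∀ π, Strategy2 Set.univ E S1 π →
          play S1 σ π s ∈
            (WeakParityEven p ∩ {ω | sInf (p '' Set.range ω) ≤ i}) ∪
              Reach (⋃ j ∈ {j : ℕ | j < i ∧ Even j}, algoA E S1 p j) := by
  intro i _ hi s hs
  have hC := algoS_total E S1 hE p i
  simp only [algoA, attrStep, if_pos hi] at hs
  obtain ⟨hsC, σ0, hσ0, hwin⟩ := hs
  choose e he using hE
  obtain ⟨g, hg⟩ := exists_strat _ E hC
  refine ⟨fun w u => if u ∈ algoS E S1 p i then σ0 w u else e u, ?_, ?_⟩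
  · intro w u _ hu
    by_cases h : u ∈ algoS E S1 p i
    · simp only [if_pos h]; exact ⟨(hσ0 w u h hu).1, trivial⟩
    · simp only [if_neg h]; exact ⟨he u, trivial⟩
  · intro π hπ
    set σ : List S → S → S := fun w u => if u ∈ algoS E S1 p i then σ0 w u else e u with hσ
    by_cases hR : play S1 σ π s ∈ Reach (⋃ j ∈ {j : ℕ | j < i ∧ Even j}, algoA E S1 p j)
    · exact Or.inr hR
    left
    have stay : ∀ n, (playAux S1 σ π s n).2 ∈ algoS E S1 p i := by
      intro n
      induction n with
      | zero => exact hsC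
      | succ n ih =>
        by_cases h : (playAux S1 σ π s n).2 ∈ S1
        · have hstep : (playAux S1 σ π s (n + 1)).2 =
              σ (playAux S1 σ π s n).1 (playAux S1 σ π s n).2 := by
            simp only [playAux, if_pos h]
          have hstep2 : σ (playAux S1 σ π s n).1 (playAux S1 σ π s n).2 =
              σ0 (playAux S1 σ π s n).1 (playAux S1 σ π s n).2 := if_pos ih
          rw [hstep, hstep2]
          exact (hσ0 _ _ ih h).2
        · by_contra hcon
          have hstep : (playAux S1 σ π s (n + 1)).2 =
              π (playAux S1 σ π s n).1 (playAux S1 σ π s n).2 := by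
            simp only [playAux, if_neg h]
          obtain ⟨j, hj, hjA⟩ := algoS_escape E S1 (fun s => ⟨e s, he s⟩) p i _ ih h _
            (hπ (playAux S1 σ π s n).1 _ trivial h).1 (hstep ▸ hcon)
          apply hR
          refine ⟨n + 1, ?_⟩
          simp only [play, hstep]
          exact Set.mem_biUnion hj hjA
    let π' : List S → S → S := fun w u => if π w u ∈ algoS E S1 p i then π w u else g u
    have hπ' : Strategy2 (algoS E S1 p i) E S1 π' := by
      intro w u hu hu1
      by_cases h : π w u ∈ algoS E S1 p i
      · simp only [π', if_pos h]; exact ⟨(hπ w u trivial hu1).1, h⟩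
      · simp only [π', if_neg h]; exact hg u hu
    have key : ∀ n, playAux S1 σ π s n = playAux S1 σ0 π' s n := by
      apply playAux_congr_of
      · intro n _
        exact if_pos (stay n)
      · intro n h
        have h3 := stay (n + 1)
        simp only [playAux, if_neg h] at h3
        exact (if_pos h3).symm
    obtain ⟨n, hn⟩ := hwin π' hπ'
    have hmin : sInf (p '' Set.range (play S1 σ π s)) = i := by
      apply le_antisymm
      · apply Nat.sInf_le
        refine ⟨_, ⟨n, rfl⟩, ?_⟩
        simp only [play] at hn ⊢
        rw [key]
        exact hn.1
      · apply le_csInf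
        · exact ⟨_, _, ⟨0, rfl⟩, rfl⟩
        · rintro _ ⟨_, ⟨m, rfl⟩, rfl⟩
          exact algoS_le E S1 (fun s => ⟨e s, he s⟩) p i _ (stay m)
    refine ⟨?_, ?_⟩
    · simp only [WeakParityEven, Set.mem_ofPred_eq, hmin]; exact hi
    · simp only [Set.mem_ofPred_eq, hmin]; exact le_rfl
end
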